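/- Suppose the set B⁺ is nonempty. Then the set R⁺ = {s ∈ ℝ : ∃x₀ with (s,x₀) ∈ B⁺} is either all of ℝ or an open positive half-line (α₀, ∞) for some α₀ ∈ ℝ; there is a function r : R⁺ → (−m, ∞) which is a solution of x' = h(t,x) on R⁺ and satisfies B⁺_s = [r(s), ∞) for every s ∈ R⁺; moreover, for s ∈ R⁺ the solution x(t,s,x₀) is bounded as t → ∞ if and only if x₀ ≥ r(s); and if inf R⁺ > −∞, then r(t) → ∞ as t → (inf R⁺)⁺. -/

import Mathlib

open Set Filter

/-- The family of maximal solutions `t ↦ X t s x₀` of the scalar ODE `x' = h (t, x)`. -/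
structure MaxSolFamily (h : ℝ → ℝ → ℝ) where
  X : ℝ → ℝ → ℝ → ℝ
  dom : ℝ → ℝ → Set ℝ
  dom_open : ∀ s x₀, IsOpen (dom s x₀)
  dom_ordConn : ∀ s x₀, (dom s x₀).OrdConnected
  mem_dom : ∀ s x₀, s ∈ dom s x₀
  init : ∀ s x₀, X s s x₀ = x₀
  sol : ∀ s x₀, ∀ t ∈ dom s x₀, HasDerivAt (fun τ => X τ s x₀) (h t (X t s x₀)) t
  maximal : ∀ s x₀ (y : ℝ → ℝ) (I : Set ℝ), IsOpen I → I.OrdConnected → s ∈ I →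
      y s = x₀ → (∀ t ∈ I, HasDerivAt y (h t (y t)) t) →
      I ⊆ dom s x₀ ∧ ∀ t ∈ I, y t = X t s x₀

/-- The set `B⁺` of initial pairs whose solution is bounded below in the future
(on the part of its maximal interval from the initial time on). -/
def Bplus {h : ℝ → ℝ → ℝ} (F : MaxSolFamily h) : Set (ℝ × ℝ) :=
  {sx | BddBelow ((fun t => F.X t sx.1 sx.2) '' (F.dom sx.1 sx.2 ∩ Ici sx.1))}

/-- `R⁺ = {s : ∃ x₀, (s, x₀) ∈ B⁺}`. -/
def Rplus {h : ℝ → ℝ → ℝ} (F : MaxSolFamily h) : Set ℝ :=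
  {s | ∃ x₀, (s, x₀) ∈ Bplus F}

/-- The solution `X · s x₀` is (defined and) bounded as `t → ∞`. -/
def BddAtTop {h : ℝ → ℝ → ℝ} (F : MaxSolFamily h) (s x₀ : ℝ) : Prop :=
  ∃ C : ℝ, ∀ᶠ t in atTop, t ∈ F.dom s x₀ ∧ |F.X t s x₀| ≤ C

namespace MaxSolFamily

variable {h : ℝ → ℝ → ℝ} (F : MaxSolFamily h)

lemma continuousOn (s x : ℝ) : ContinuousOn (fun t => F.X t s x) (F.dom s x) :=
  fun t ht => (F.sol s x t ht).continuousAt.continuousWithinAt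

lemma Icc_subset_dom {s x a b : ℝ} (ha : a ∈ F.dom s x) (hb : b ∈ F.dom s x) :
    Icc a b ⊆ F.dom s x :=
  (F.dom_ordConn s x).out ha hb

/-- The cocycle property of the family of maximal solutions. -/
lemma flow {s x t : ℝ} (ht : t ∈ F.dom s x) :
    F.dom t (F.X t s x) = F.dom s x ∧
      ∀ u ∈ F.dom s x, F.X u t (F.X t s x) = F.X u s x := by
  obtain ⟨hsub, heq⟩ := F.maximal t (F.X t s x) (fun u => F.X u s x) (F.dom s x)
    (F.dom_open s x) (F.dom_ordConn s x) ht rfl (F.sol s x)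
  have hs := F.mem_dom s x
  refine ⟨(Subset.antisymm ?_ hsub), fun u hu => (heq u hu).symm⟩
  refine (F.maximal s x (fun u => F.X u t (F.X t s x)) _ (F.dom_open _ _) (F.dom_ordConn _ _)
    (hsub hs) ?_ (F.sol _ _)).1
  rw [← heq s hs, F.init]

lemma X_lt_X {s t x y : ℝ} (hx : t ∈ F.dom s x) (hy : t ∈ F.dom s y) (hxy : x < y) :
    F.X t s x < F.X t s y := by
  by_contra! hle
  have hsubx : uIcc s t ⊆ F.dom s x := (F.dom_ordConn s x).uIcc_subset (F.mem_dom s x) hx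
  have hsuby : uIcc s t ⊆ F.dom s y := (F.dom_ordConn s y).uIcc_subset (F.mem_dom s y) hy
  have hc : ContinuousOn (fun u => F.X u s y - F.X u s x) (uIcc s t) :=
    ((F.continuousOn s y).mono hsuby).sub ((F.continuousOn s x).mono hsubx)
  have hmem : (0 : ℝ) ∈ uIcc (F.X s s y - F.X s s x) (F.X t s y - F.X t s x) := by
    rw [F.init, F.init]
    exact mem_uIcc.2 (Or.inr ⟨by linarith, by linarith⟩)
  obtain ⟨u, hu, hu0⟩ := intermediate_value_uIcc hc hmem
  have h1 := (F.flow (hsubx hu)).2 s (F.mem_dom s x)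
  have h2 := (F.flow (hsuby hu)).2 s (F.mem_dom s y)
  have h3 : F.X u s x = F.X u s y := by simp only at hu0; linarith
  rw [F.init] at h1 h2
  rw [h3] at h1
  linarith

/-- Time reversal of a family of maximal solutions. -/
def reverse : MaxSolFamily (fun t x => -h (-t) x) where
  X t s x := F.X (-t) (-s) x
  dom s x := Neg.neg ⁻¹' F.dom (-s) x
  dom_open s x := (F.dom_open (-s) x).preimage continuous_neg
  dom_ordConn s x := ⟨fun a ha b hb c hc =>
    (F.dom_ordConn (-s) x).out hb ha ⟨neg_le_neg hc.2, neg_le_neg hc.1⟩⟩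
  mem_dom s x := F.mem_dom (-s) x
  init s x := F.init (-s) x
  sol s x t ht := by
    have := (F.sol (-s) x (-t) ht).comp t (hasDerivAt_neg t)
    simpa [Function.comp_def] using this
  maximal s x y I hI hconn hs hy hsol := by
    have key := F.maximal (-s) x (fun t => y (-t)) (Neg.neg ⁻¹' I) (hI.preimage continuous_neg)
      ⟨fun a ha b hb c hc => hconn.out hb ha ⟨neg_le_neg hc.2, neg_le_neg hc.1⟩⟩
      (by simpa using hs) (by simpa using hy) (fun t ht => by
        have := (hsol (-t) ht).comp t (hasDerivAt_neg t)
        simpa [Function.comp_def] using this)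
    refine ⟨fun t ht => key.1 (by simpa using ht), fun t ht => ?_⟩
    simpa using key.2 (-t) (by simpa using ht)

/-- A solution that is bounded on `[s, b)` extends to `b`. -/
lemma mem_dom_of_bounded_Ico (hcont : Continuous fun q : ℝ × ℝ => h q.1 q.2)
    {s x b C : ℝ} (hsb : s < b) (hsub : Ico s b ⊆ F.dom s x)
    (hC : ∀ u ∈ Ico s b, |F.X u s x| ≤ C) : b ∈ F.dom s x := by
  have hcpt : IsCompact (Icc s b ×ˢ Icc (-C) C) := isCompact_Icc.prod isCompact_Icc
  obtain ⟨K, hK⟩ := hcpt.exists_bound_of_continuousOn hcont.continuousOn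
  have hderiv : ∀ u ∈ Ico s b, |h u (F.X u s x)| ≤ K := fun u hu =>
    hK (u, F.X u s x) ⟨⟨hu.1, hu.2.le⟩, abs_le.1 (hC u hu)⟩
  obtain ⟨L, hL⟩ : ∃ L, Tendsto (fun u => F.X u s x) (nhdsWithin b (Iio b)) (nhds L) := by
    have hder : ∀ u ∈ Ioo s b,
        HasDerivAt (fun u => F.X u s x + K * u) (h u (F.X u s x) + K) u := fun u hu => by
      simpa [Pi.add_def] using
        (F.sol s x u (hsub ⟨hu.1.le, hu.2⟩)).add ((hasDerivAt_id u).const_mul K)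
    have hmono : MonotoneOn (fun u => F.X u s x + K * u) (Ioo s b) := by
      refine monotoneOn_of_deriv_nonneg (convex_Ioo s b)
        (fun u hu => (hder u hu).continuousAt.continuousWithinAt) ?_ ?_ <;> rw [interior_Ioo]
      · exact fun u hu => (hder u hu).differentiableAt.differentiableWithinAt
      · intro u hu
        rw [(hder u hu).deriv]
        linarith [(abs_le.1 (hderiv u ⟨hu.1.le, hu.2⟩)).1]
    have hbdd : BddAbove ((fun u => F.X u s x + K * u) '' Ioo s b) := by
      refine ⟨C + |K| * (|s| + |b|), ?_⟩
      rintro _ ⟨u, hu, rfl⟩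
      have h1 := (abs_le.1 (hC u ⟨hu.1.le, hu.2⟩)).2
      have h2 : |u| ≤ |s| + |b| := by
        rw [abs_le]
        constructor <;>
          linarith [hu.1, hu.2, neg_abs_le s, le_abs_self b, abs_nonneg s, abs_nonneg b]
      have h3 : K * u ≤ |K| * |u| := by rw [← abs_mul]; exact le_abs_self _
      have h4 := mul_le_mul_of_nonneg_left h2 (abs_nonneg K)
      simp only
      linarith
    have hlim := hmono.tendsto_nhdsWithin_Ioo_left (nonempty_Ioo.2 hsb) hbdd
    have hlin : Tendsto (fun u : ℝ => K * u) (nhdsWithin b (Iio b)) (nhds (K * b)) :=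
      ((continuous_const.mul continuous_id).tendsto b).mono_left nhdsWithin_le_nhds
    exact ⟨_, by simpa using hlim.sub hlin⟩
  obtain ⟨δ, hδ, hball⟩ := Metric.isOpen_iff.1 (F.dom_open b L) b (F.mem_dom b L)
  rw [Real.ball_eq_Ioo] at hball
  set y : ℝ → ℝ := fun t => if t < b then F.X t s x else F.X t b L with hy
  have hyb : y b = L := by simp [hy, F.init]
  have hleft : ∀ t < b, y =ᶠ[nhds t] fun u => F.X u s x := fun t ht => by
    filter_upwards [Iio_mem_nhds ht] with u hu
    exact if_pos hu
  have hy_lt : ∀ t ∈ Ioo s b, HasDerivAt y (h t (y t)) t := fun t ht => by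
    rw [(hleft t ht.2).eq_of_nhds]
    exact (F.sol s x t (hsub ⟨ht.1.le, ht.2⟩)).congr_of_eventuallyEq (hleft t ht.2)
  have hylim : Tendsto y (nhdsWithin b (Iio b)) (nhds L) :=
    hL.congr' (by filter_upwards [self_mem_nhdsWithin] with u hu using (if_pos hu).symm)
  have hy_b : HasDerivAt y (h b (y b)) b := by
    have hl : HasDerivWithinAt y (h b (y b)) (Iic b) b := by
      refine hasDerivWithinAt_Iic_of_tendsto_deriv (s := Ioo s b)
        (fun t ht => (hy_lt t ht).differentiableAt.differentiableWithinAt) ?_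
        (Ioo_mem_nhdsLT hsb) ?_
      · rw [ContinuousWithinAt, hyb]
        exact hylim.mono_left (nhdsWithin_mono b fun u hu => hu.2)
      · have hlim : Tendsto (fun t => h t (y t)) (nhdsWithin b (Iio b)) (nhds (h b (y b))) := by
          have hpair : Tendsto (fun t => (t, y t)) (nhdsWithin b (Iio b)) (nhds (b, y b)) := by
            rw [hyb]
            exact (tendsto_id.mono_left nhdsWithin_le_nhds).prodMk_nhds hylim
          exact (hcont.tendsto (b, y b)).comp hpair
        refine hlim.congr' ?_
        filter_upwards [Ioo_mem_nhdsLT hsb] with t ht using (hy_lt t ht).deriv.symm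
    have hr : HasDerivWithinAt y (h b (y b)) (Ici b) b := by
      have := (F.sol b L b (F.mem_dom b L)).hasDerivWithinAt (s := Ici b)
      rw [F.init, ← hyb] at this
      rw [hyb] at this ⊢
      exact this.congr (fun u hu => if_neg (not_lt.2 hu)) (if_neg (lt_irrefl b))
    simpa using (hl.union hr)
  obtain ⟨u, hu⟩ := exists_between hsb
  have hudom := hsub ⟨hu.1.le, hu.2⟩
  have hmax := F.maximal u (F.X u s x) y (Ioo s (b + δ)) isOpen_Ioo ordConnected_Ioo
    ⟨hu.1, by linarith [hu.2]⟩ (if_pos hu.2) (fun t ht => by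
      rcases lt_trichotomy t b with htb | rfl | htb
      · exact hy_lt t ⟨ht.1, htb⟩
      · exact hy_b
      · have hright : y =ᶠ[nhds t] fun u => F.X u b L := by
          filter_upwards [Ioi_mem_nhds htb] with v hv
          exact if_neg (not_lt.2 (le_of_lt hv))
        rw [hright.eq_of_nhds]
        exact (F.sol b L t (hball ⟨by linarith, ht.2⟩)).congr_of_eventuallyEq hright)
  rw [(F.flow hudom).1] at hmax
  exact hmax.1 ⟨hsb, by linarith⟩

/-- An a priori bound on `[s, t]` forces a solution to exist up to time `t`. -/
lemma mem_dom_of_le (hcont : Continuous fun q : ℝ × ℝ => h q.1 q.2)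
    {s x t C : ℝ} (hst : s ≤ t)
    (hC : ∀ u ∈ F.dom s x, u ∈ Icc s t → |F.X u s x| ≤ C) : t ∈ F.dom s x := by
  by_contra ht
  set S := F.dom s x ∩ Ici s
  have hsS : s ∈ S := ⟨F.mem_dom s x, self_mem_Ici⟩
  have hub : ∀ u ∈ S, u ≤ t := fun u hu => by
    by_contra! htu
    exact ht (F.Icc_subset_dom (F.mem_dom s x) hu.1 ⟨hst, htu.le⟩)
  have hbdd : BddAbove S := ⟨t, hub⟩
  have hgt : ∀ u ∈ F.dom s x, ∃ v ∈ F.dom s x, u < v := fun u hu => by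
    have hev : ∀ᶠ v in nhdsWithin u (Ioi u), v ∈ F.dom s x ∧ u < v :=
      (eventually_nhdsWithin_of_eventually_nhds ((F.dom_open s x).mem_nhds hu)).and
        self_mem_nhdsWithin
    exact hev.exists
  have hlt : ∀ u ∈ S, u < sSup S := fun u hu => by
    obtain ⟨v, hv, huv⟩ := hgt u hu.1
    exact huv.trans_le (le_csSup hbdd ⟨hv, le_trans hu.2 huv.le⟩)
  have hsub : Ico s (sSup S) ⊆ F.dom s x := fun u hu => by
    obtain ⟨v, hv, huv⟩ := exists_lt_of_lt_csSup ⟨s, hsS⟩ hu.2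
    exact F.Icc_subset_dom (F.mem_dom s x) hv.1 ⟨hu.1, huv.le⟩
  have hmem := F.mem_dom_of_bounded_Ico hcont (hlt s hsS) hsub fun u hu =>
    hC u (hsub hu) ⟨hu.1, hub u ⟨hsub hu, hu.1⟩⟩
  exact lt_irrefl _ (hlt _ ⟨hmem, (hlt s hsS).le⟩)

/-- An a priori bound on `[t, s]` forces a solution to exist back to time `t`. -/
lemma mem_dom_of_ge (hcont : Continuous fun q : ℝ × ℝ => h q.1 q.2)
    {s x t C : ℝ} (hts : t ≤ s)
    (hC : ∀ u ∈ F.dom s x, u ∈ Icc t s → |F.X u s x| ≤ C) : t ∈ F.dom s x := by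
  have key := F.reverse.mem_dom_of_le (s := -s) (t := -t) (x := x) (C := C)
    (hcont.comp (continuous_neg.prodMap continuous_id)).neg (neg_le_neg hts) (fun u hu hmem => by
      have hu' : -u ∈ F.dom s x := by simpa [reverse] using hu
      simpa [reverse] using hC (-u) hu' ⟨by linarith [hmem.2], by linarith [hmem.1]⟩)
  simpa [reverse] using key

/-- A level at which the vector field is negative cannot be crossed upwards. -/
lemma X_le_of_neg {C : ℝ} (hneg : ∀ t, h t C < 0) {s x t : ℝ} (hst : s ≤ t)
    (ht : t ∈ F.dom s x) (hx : x ≤ C) : F.X t s x ≤ C := by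
  have hsub := F.Icc_subset_dom (F.mem_dom s x) ht
  refine image_le_of_deriv_right_lt_deriv_boundary (f := fun u => F.X u s x)
    (f' := fun u => h u (F.X u s x)) (B := fun _ => C) (B' := fun _ => 0)
    ((F.continuousOn s x).mono hsub)
    (fun u hu => (F.sol s x u (hsub ⟨hu.1, hu.2.le⟩)).hasDerivWithinAt)
    (by simpa [F.init] using hx) (fun u => hasDerivAt_const u C)
    (fun u _ hu => ?_) ⟨hst, le_rfl⟩
  rw [hu]
  exact hneg u

lemma bddBelow_image_dom_inter_Ici {s x a b : ℝ} (ha : a ∈ F.dom s x) (hb : b ∈ F.dom s x)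
    (hbdd : BddBelow ((fun t => F.X t s x) '' (F.dom s x ∩ Ici a))) :
    BddBelow ((fun t => F.X t s x) '' (F.dom s x ∩ Ici b)) := by
  have hIcc : BddBelow ((fun t => F.X t s x) '' Icc b a) :=
    isCompact_Icc.bddBelow_image ((F.continuousOn s x).mono (F.Icc_subset_dom hb ha))
  refine (hbdd.union hIcc).mono ?_
  rw [← image_union]
  refine image_mono fun u hu => ?_
  rcases le_total a u with hau | hua
  · exact Or.inl ⟨hu.1, hau⟩
  · exact Or.inr ⟨hu.2, hua⟩

/-- The set `B⁺` is invariant under the flow, forwards and backwards. -/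
lemma mem_Bplus_of_mem_dom {s x t : ℝ} (hsx : (s, x) ∈ Bplus F) (ht : t ∈ F.dom s x) :
    (t, F.X t s x) ∈ Bplus F := by
  have hb := F.bddBelow_image_dom_inter_Ici (F.mem_dom s x) ht hsx
  rw [Bplus, mem_ofPred_eq]
  rw [(F.flow ht).1, image_congr fun u hu => (F.flow ht).2 u hu.1]
  exact hb

section Dissipative

variable {m : ℝ}

lemma le_X_of_le {c : ℝ} (hneg : ∀ t y, m ≤ |y| → h t y < 0) (hm : 0 < m) (hc : c ≤ -m)
    {s x t : ℝ} (hts : t ≤ s) (ht : t ∈ F.dom s x) (hx : c ≤ x) : c ≤ F.X t s x := by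
  by_contra! hlt
  obtain ⟨hdom, heq⟩ := F.flow ht
  have := F.X_le_of_neg (C := F.X t s x)
    (fun u => hneg u _ (by rw [abs_of_neg (by linarith)]; linarith)) hts
    (hdom ▸ F.mem_dom s x) le_rfl
  rw [heq s (F.mem_dom s x), F.init] at this
  linarith

/-- Solutions that start below a given solution exist backwards at least as long as it does. -/
lemma mem_dom_of_le_X (hcont : Continuous fun q : ℝ × ℝ => h q.1 q.2)
    (hneg : ∀ t y, m ≤ |y| → h t y < 0) (hm : 0 < m) {s b t z : ℝ} (hst : s ≤ t)
    (ht : t ∈ F.dom s b) (hz : z ≤ F.X t s b) : s ∈ F.dom t z := by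
  obtain ⟨hdom, heq⟩ := F.flow ht
  rcases hz.eq_or_lt with rfl | hz
  · exact hdom ▸ F.mem_dom s b
  have hsub := F.Icc_subset_dom (F.mem_dom s b) ht
  obtain ⟨C, hC⟩ := isCompact_Icc.exists_bound_of_continuousOn ((F.continuousOn s b).mono hsub)
  refine F.mem_dom_of_ge hcont (C := max C (max |z| m)) hst fun u hu hmem => abs_le.2 ⟨?_, ?_⟩
  · refine F.le_X_of_le hneg hm ?_ hmem.2 hu ?_
    · exact neg_le_neg ((le_max_right _ _).trans (le_max_right _ _))
    · refine (neg_le_neg ((le_max_left _ _).trans (le_max_right _ _))).trans (neg_abs_le z)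
  · have h1 := F.X_lt_X hu (hdom ▸ hsub hmem) hz
    rw [heq u (hsub hmem)] at h1
    exact (h1.le.trans (le_abs_self _)).trans ((hC u hmem).trans (le_max_left _ _))

/-- Solutions starting in `B⁺` are global and bounded in the future. -/
lemma forward_bounded (hcont : Continuous fun q : ℝ × ℝ => h q.1 q.2)
    (hneg : ∀ t y, m ≤ |y| → h t y < 0) {s x : ℝ} (hsx : (s, x) ∈ Bplus F) :
    ∃ C, ∀ t, s ≤ t → t ∈ F.dom s x ∧ |F.X t s x| ≤ C := by
  obtain ⟨c, hc⟩ := hsx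
  have hbd : ∀ t ∈ F.dom s x, s ≤ t → |F.X t s x| ≤ max (-c) (max |x| m) := by
    refine fun t ht hst => abs_le.2 ⟨?_, ?_⟩
    · linarith [hc (mem_image_of_mem _ ⟨ht, hst⟩), le_max_left (-c) (max |x| m)]
    · refine (F.X_le_of_neg (C := max |x| m) (fun u => hneg u _ ?_) hst ht
        ((le_abs_self x).trans (le_max_left _ _))).trans (le_max_right _ _)
      exact (le_max_right _ _).trans (le_abs_self _)
  have hdom : ∀ t, s ≤ t → t ∈ F.dom s x := fun t hst =>
    F.mem_dom_of_le hcont hst fun u hu hmem => hbd u hu hmem.1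
  exact ⟨_, fun t hst => ⟨hdom t hst, hbd t (hdom t hst) hst⟩⟩

lemma neg_lt_of_mem_Bplus (hcont : Continuous fun q : ℝ × ℝ => h q.1 q.2)
    {ε : ℝ} (hε : 0 < ε) (hm : 0 < m) (hem : ∀ t y, m ≤ |y| → h t y ≤ -ε)
    {s x : ℝ} (hsx : (s, x) ∈ Bplus F) : -m < x := by
  by_contra! hx
  have hneg : ∀ t y, m ≤ |y| → h t y < 0 := fun t y hy => by linarith [hem t y hy]
  obtain ⟨C, hC⟩ := F.forward_bounded hcont hneg hsx
  have hle : ∀ t, s ≤ t → F.X t s x ≤ -m := fun t hst =>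
    F.X_le_of_neg (fun u => hneg u _ (by simp [le_abs_self])) hst (hC t hst).1 hx
  have hdecay : ∀ t, s ≤ t → F.X t s x ≤ x - ε * (t - s) := fun t hst => by
    refine image_le_of_deriv_right_le_deriv_boundary (f := fun u => F.X u s x)
      (f' := fun u => h u (F.X u s x)) (B := fun u => x - ε * (u - s)) (B' := fun _ => -ε)
      (a := s) (b := t)
      ((F.continuousOn s x).mono fun u hu => (hC u hu.1).1)
      (fun u hu => (F.sol s x u (hC u hu.1).1).hasDerivWithinAt)
      (by simp [F.init]) (by fun_prop)
      (fun u _ => ?_) (fun u hu => hem u _ ?_) ⟨hst, le_rfl⟩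
    · simpa using ((((hasDerivAt_id u).sub_const s).const_mul ε).const_sub x).hasDerivWithinAt
    · rw [abs_of_neg (by linarith [hle u hu.1])]
      linarith [hle u hu.1]
  have hC0 : 0 ≤ C := (abs_nonneg _).trans (hC s le_rfl).2
  have hst : s ≤ s + (C + 1) / ε := by
    have : 0 ≤ (C + 1) / ε := by positivity
    linarith
  have h1 := hdecay _ hst
  have h2 := (abs_le.1 (hC _ hst).2).1
  have h3 : ε * (s + (C + 1) / ε - s) = C + 1 := by field_simp; ring
  linarith

lemma mem_Bplus_of_le (hcont : Continuous fun q : ℝ × ℝ => h q.1 q.2)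
    (hneg : ∀ t y, m ≤ |y| → h t y < 0) {s x y : ℝ} (hsx : (s, x) ∈ Bplus F) (hxy : x ≤ y) :
    (s, y) ∈ Bplus F := by
  rcases hxy.eq_or_lt with rfl | hxy
  · exact hsx
  obtain ⟨C, hC⟩ := F.forward_bounded hcont hneg hsx
  refine ⟨-C, ?_⟩
  rintro _ ⟨t, ⟨ht, hst⟩, rfl⟩
  have h1 := F.X_lt_X (hC t hst).1 ht hxy
  have h2 := (abs_le.1 (hC t hst).2).1
  simp only at h1 h2 ⊢
  linarith

/-- The infimum of a nonempty section of `B⁺` belongs to the section. -/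
lemma sInf_mem_Bplus (hcont : Continuous fun q : ℝ × ℝ => h q.1 q.2)
    {ε : ℝ} (hε : 0 < ε) (hm : 0 < m) (hem : ∀ t y, m ≤ |y| → h t y ≤ -ε)
    {s : ℝ} (hs : s ∈ Rplus F) : (s, sInf {x | (s, x) ∈ Bplus F}) ∈ Bplus F := by
  have hneg : ∀ t y, m ≤ |y| → h t y < 0 := fun t y hy => by linarith [hem t y hy]
  set S : Set ℝ := {x | (s, x) ∈ Bplus F} with hS
  have hSne : S.Nonempty := hs
  by_contra hnot
  obtain ⟨t, ⟨ht, hst⟩, htm⟩ : ∃ t ∈ F.dom s (sInf S) ∩ Ici s, F.X t s (sInf S) < -m := by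
    by_contra! hge
    exact hnot ⟨-m, by rintro _ ⟨t, ht, rfl⟩; exact hge t ht⟩
  obtain ⟨z, hz, hzm⟩ := exists_between htm
  obtain ⟨y, hy⟩ := hSne
  obtain ⟨C, hC⟩ := F.forward_bounded hcont hneg hy
  have hty := (hC t hst).1
  have hym := F.neg_lt_of_mem_Bplus hcont hε hm hem (F.mem_Bplus_of_mem_dom hy hty)
  have hsz := F.mem_dom_of_le_X hcont hneg hm hst hty (by linarith : z ≤ F.X t s y)
  obtain ⟨hdom, heq⟩ := F.flow ht
  have hlt := F.X_lt_X (hdom ▸ F.mem_dom s _) hsz hz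
  rw [heq s (F.mem_dom s _), F.init] at hlt
  obtain ⟨w, hw, hwz⟩ := exists_lt_of_csInf_lt ⟨y, hy⟩ hlt
  have hzB := F.mem_Bplus_of_le hcont hneg hw hwz.le
  obtain ⟨hdom', heq'⟩ := F.flow hsz
  have htz : t ∈ F.dom s (F.X s t z) := hdom' ▸ F.mem_dom t z
  have := F.neg_lt_of_mem_Bplus hcont hε hm hem (F.mem_Bplus_of_mem_dom hzB htz)
  rw [heq' t (F.mem_dom t z), F.init] at this
  linarith

end Dissipative

end MaxSolFamily

theorem stmt1 (h : ℝ → ℝ → ℝ)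
    (hcont : Continuous fun q : ℝ × ℝ => h q.1 q.2)
    (hlip : ∀ q : ℝ × ℝ, ∃ K : ℝ, ∃ U ∈ nhds q, ∀ t x y : ℝ,
      (t, x) ∈ U → (t, y) ∈ U → |h t x - h t y| ≤ K * |x - y|)
    (hcoer : ∃ μ > (0:ℝ), ∃ M > (0:ℝ), ∀ t x : ℝ, M ≤ |x| → h t x ≤ -μ * x ^ 2)
    (F : MaxSolFamily h)
    (ε m : ℝ) (hε : 0 < ε) (hm : 0 < m)
    (hem : ∀ t x : ℝ, m ≤ x → h t x ≤ -ε ∧ h t (-x) ≤ -ε)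
    (hne : (Bplus F).Nonempty) :
    (Rplus F = Set.univ ∨ ∃ α₀ : ℝ, Rplus F = Set.Ioi α₀) ∧
    ∃ r : ℝ → ℝ,
      (∀ s ∈ Rplus F, -m < r s) ∧
      (∀ t ∈ Rplus F, HasDerivAt r (h t (r t)) t) ∧
      (∀ s ∈ Rplus F, ∀ x₀ : ℝ, (s, x₀) ∈ Bplus F ↔ r s ≤ x₀) ∧
      (∀ s ∈ Rplus F, ∀ x₀ : ℝ, BddAtTop F s x₀ ↔ r s ≤ x₀) ∧
      (∀ α₀ : ℝ, Rplus F = Set.Ioi α₀ →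
        Filter.Tendsto r (nhdsWithin α₀ (Set.Ioi α₀)) Filter.atTop) := by
  have hem' : ∀ t y, m ≤ |y| → h t y ≤ -ε := fun t y hy => by
    rcases le_abs'.1 hy with hy | hy
    · simpa using (hem t (-y) (by linarith)).2
    · exact (hem t y hy).1
  have hneg : ∀ t y, m ≤ |y| → h t y < 0 := fun t y hy => by linarith [hem' t y hy]
  set r : ℝ → ℝ := fun s => sInf {x | (s, x) ∈ Bplus F} with hr
  have hrB : ∀ s ∈ Rplus F, (s, r s) ∈ Bplus F := fun s hs =>
    F.sInf_mem_Bplus hcont hε hm hem' hs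
  have hlow : ∀ s x, (s, x) ∈ Bplus F → -m < x := fun s x hsx =>
    F.neg_lt_of_mem_Bplus hcont hε hm hem' hsx
  have hr_le : ∀ s x, (s, x) ∈ Bplus F → r s ≤ x := fun s x hsx =>
    csInf_le ⟨-m, fun y hy => (hlow s y hy).le⟩ hsx
  have hBiff : ∀ s ∈ Rplus F, ∀ x, (s, x) ∈ Bplus F ↔ r s ≤ x := fun s hs x =>
    ⟨hr_le s x, F.mem_Bplus_of_le hcont hneg (hrB s hs)⟩
  have hdom : ∀ s ∈ Rplus F, ∀ t, s ≤ t → t ∈ F.dom s (r s) := fun s hs t hst => by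
    obtain ⟨C, hC⟩ := F.forward_bounded hcont hneg (hrB s hs)
    exact (hC t hst).1
  have hR : ∀ s ∈ Rplus F, ∀ t ∈ F.dom s (r s), t ∈ Rplus F := fun s hs t ht =>
    ⟨_, F.mem_Bplus_of_mem_dom (hrB s hs) ht⟩
  have hup : ∀ s ∈ Rplus F, ∀ t, s ≤ t → t ∈ Rplus F := fun s hs t hst =>
    hR s hs t (hdom s hs t hst)
  have hleft : ∀ s ∈ Rplus F, ∃ u ∈ Rplus F, u < s := fun s hs => by
    have hev : ∀ᶠ u in nhdsWithin s (Iio s), u ∈ F.dom s (r s) ∧ u < s :=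
      (eventually_nhdsWithin_of_eventually_nhds
        ((F.dom_open s _).mem_nhds (F.mem_dom s _))).and self_mem_nhdsWithin
    obtain ⟨u, hu, hus⟩ := hev.exists
    exact ⟨u, hR s hs u hu, hus⟩
  have hrX : ∀ s ∈ Rplus F, ∀ t, s ≤ t → r t = F.X t s (r s) := fun s hs t hst => by
    have ht := hdom s hs t hst
    have hle := hr_le t _ (F.mem_Bplus_of_mem_dom (hrB s hs) ht)
    refine hle.eq_or_lt.resolve_right fun hlt => ?_
    have hst' := F.mem_dom_of_le_X hcont hneg hm hst ht hle
    obtain ⟨hd, heq⟩ := F.flow ht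
    have h1 := F.X_lt_X hst' (hd ▸ F.mem_dom s _) hlt
    rw [heq s (F.mem_dom s _), F.init] at h1
    have h2 := hr_le s _ (F.mem_Bplus_of_mem_dom (hrB t (hup s hs t hst)) hst')
    linarith
  have hRne : (Rplus F).Nonempty := hne.elim fun q hq => ⟨q.1, q.2, hq⟩
  refine ⟨?_, r, fun s hs => hlow s _ (hrB s hs), ?_, hBiff, ?_, ?_⟩
  · by_cases hbdd : BddBelow (Rplus F)
    · refine Or.inr ⟨sInf (Rplus F), Subset.antisymm (fun s hs => ?_) fun s hs => ?_⟩
      · obtain ⟨u, hu, hus⟩ := hleft s hs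
        exact (csInf_le hbdd hu).trans_lt hus
      · obtain ⟨u, hu, hus⟩ := exists_lt_of_csInf_lt hRne hs
        exact hup u hu s hus.le
    · refine Or.inl (eq_univ_of_forall fun s => ?_)
      obtain ⟨u, hu, hus⟩ := not_bddBelow_iff.1 hbdd s
      exact hup u hu s hus.le
  · intro t ht
    obtain ⟨u, hu, hut⟩ := hleft t ht
    rw [hrX u hu t hut.le]
    refine (F.sol u (r u) t (hdom u hu t hut.le)).congr_of_eventuallyEq ?_
    filter_upwards [Ioi_mem_nhds hut] with v hv using hrX u hu v (le_of_lt hv)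
  · intro s hs x
    rw [← hBiff s hs x]
    constructor
    · rintro ⟨C, hC⟩
      obtain ⟨T, hT⟩ := eventually_atTop.1 hC
      refine F.bddBelow_image_dom_inter_Ici (hT T le_rfl).1 (F.mem_dom s x) ⟨-C, ?_⟩
      rintro _ ⟨t, ht, rfl⟩
      exact (abs_le.1 (hT t ht.2).2).1
    · intro hsx
      obtain ⟨C, hC⟩ := F.forward_bounded hcont hneg hsx
      exact ⟨C, eventually_atTop.2 ⟨s, hC⟩⟩
  · intro α₀ hα
    rw [tendsto_atTop]
    by_contra! hnot
    obtain ⟨b, hb⟩ := hnot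
    have hs : α₀ + 1 ∈ Rplus F := by rw [hα]; simp
    have hα_not : α₀ ∉ Rplus F := by rw [hα]; simp
    -- above the level `m` the function `r` is decreasing, so `r` is bounded near `α₀`
    have hbound : ∀ u, α₀ < u → r u ≤ max b m := fun u hu => by
      obtain ⟨v, hv, hvu⟩ := (hb.and_eventually (Ioo_mem_nhdsGT hu)).exists
      have hvR : v ∈ Rplus F := by rw [hα]; exact hvu.1
      rw [hrX v hvR u hvu.2.le]
      exact F.X_le_of_neg (fun t => hneg t _ ((le_max_right b m).trans (le_abs_self _)))
        hvu.2.le (hdom v hvR u hvu.2.le) (hv.le.trans (le_max_left _ _))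
    refine hα_not (hR _ hs α₀ (F.mem_dom_of_ge hcont (C := max b m) (by linarith) ?_))
    intro u hu hmem
    have huR := hR _ hs u hu
    have hud := hdom u huR _ hmem.2
    have hXu : F.X u (α₀ + 1) (r (α₀ + 1)) = r u := by
      rw [hrX u huR _ hmem.2, (F.flow hud).2 u (F.mem_dom u _), F.init]
    rw [hXu, abs_le]
    have huα : α₀ < u := by rw [hα] at huR; exact huR
    exact ⟨by linarith [hlow u _ (hrB u huR), le_max_right b m], hbound u huα⟩
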